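/- arXiv:2604.02885 — 2 statements merged into one kernel-verified Lean document; each statement's English description precedes it below -/
import Mathlib

section
/- Let a be an integer with |a| > 1 such that gcd(5, a − 1) = 5. Then gcd(7·k_5(a) − 1, Φ_4(a²)) divides 2·1297, gcd(7·k_5(a) − 1, Φ_3(a²)) divides 3·13·109, gcd(k_5(a) − 1, Φ_4(a²)) divides 2·97, and gcd(k_5(a) − 1, Φ_3(a²)) divides 3·7·31. -/
/-- `e(r,a)`: for odd prime `r` coprime to `a`, the multiplicative order of `a` modulo `r`;
for `r = 2` and odd `a`, it is `1` if `a ≡ 1 (mod 4)` and `2` if `a ≡ 3 (mod 4)`. -/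
noncomputable def eOrd (r : ℕ) (a : ℤ) : ℕ :=
  if r = 2 then (if a % 4 = 1 then 1 else 2) else orderOf (a : ZMod r)

/-- `k_i(a)`: the product, over all primitive prime divisors `r` of `a^i - 1`
(i.e. primes `r` with `e(r,a) = i`), of the `r`-part of `a^i - 1`. -/
noncomputable def kPart (i : ℕ) (a : ℤ) : ℕ :=
  ∏ r ∈ (a ^ i - 1).natAbs.primeFactors.filter (fun r => eOrd r a = i),
    r ^ (a ^ i - 1).natAbs.factorization r

/-- A prime divisor of `Φ_5(a)` other than `5` does not divide `a - 1`. -/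
theorem not_dvd_sub_one_of_dvd_cyclotomic_five {a : ℤ} {r : ℕ} (hr : r.Prime) (hne : r ≠ 5)
    (hdvd : (r : ℤ) ∣ a ^ 4 + a ^ 3 + a ^ 2 + a + 1) : ¬ (r : ℤ) ∣ a - 1 := by
  intro h
  have h' : (r : ℤ) ∣ 5 := by
    have := dvd_sub hdvd (h.mul_right (a ^ 3 + 2 * a ^ 2 + 3 * a + 4))
    ring_nf at this
    exact this
  exact hne ((Nat.prime_dvd_prime_iff_eq hr Nat.prime_five).mp (by exact_mod_cast h'))

/-- A prime divides `a ^ 5 - 1` primitively iff it is a prime factor of `Φ_5(a)` other than `5`,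
provided that `5 ∣ a - 1`. -/
theorem eOrd_eq_five_iff {a : ℤ} (h5 : (5 : ℤ) ∣ a - 1) {r : ℕ} (hr : r.Prime) :
    (r : ℤ) ∣ a ^ 5 - 1 ∧ eOrd r a = 5 ↔ (r : ℤ) ∣ a ^ 4 + a ^ 3 + a ^ 2 + a + 1 ∧ r ≠ 5 := by
  have hfac : a ^ 5 - 1 = (a - 1) * (a ^ 4 + a ^ 3 + a ^ 2 + a + 1) := by ring
  have hone : (a : ZMod r) = 1 ↔ (r : ℤ) ∣ a - 1 := by
    rw [← ZMod.intCast_zmod_eq_zero_iff_dvd, Int.cast_sub, Int.cast_one, sub_eq_zero]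
  constructor
  · rintro ⟨hdvd, hord⟩
    have hr2 : r ≠ 2 := by
      rintro rfl
      unfold eOrd at hord
      split_ifs at hord <;> omega
    rw [eOrd, if_neg hr2] at hord
    have hna : ¬ (r : ℤ) ∣ a - 1 := by
      rw [← hone]
      intro h
      simp [h] at hord
    refine ⟨?_, ?_⟩
    · rw [hfac] at hdvd
      exact ((Nat.prime_iff_prime_int.mp hr).dvd_or_dvd hdvd).resolve_left hna
    · rintro rfl
      exact hna h5
  · rintro ⟨hdvd, hne⟩
    have hna := not_dvd_sub_one_of_dvd_cyclotomic_five hr hne hdvd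
    have hr2 : r ≠ 2 := by
      rintro rfl
      have ha : a % 2 = 0 := by push_cast at hna; omega
      obtain ⟨b, rfl⟩ := Int.dvd_of_emod_eq_zero ha
      ring_nf at hdvd
      omega
    have hpow : (r : ℤ) ∣ a ^ 5 - 1 := hfac ▸ hdvd.mul_left _
    refine ⟨hpow, ?_⟩
    rw [eOrd, if_neg hr2]
    have := Fact.mk Nat.prime_five
    refine orderOf_eq_prime ?_ (hone.not.mpr hna)
    rw [← ZMod.intCast_zmod_eq_zero_iff_dvd] at hpow
    push_cast at hpow
    exact sub_eq_zero.mp hpow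

/-- If `5 ∣ a - 1` then `Φ_5(a) = 5 k_5(a)`. -/
theorem five_mul_kPart_five {a : ℤ} (ha : 1 < a.natAbs) (h5 : (5 : ℤ) ∣ a - 1) :
    5 * (kPart 5 a : ℤ) = a ^ 4 + a ^ 3 + a ^ 2 + a + 1 := by
  have hpos : 0 < a ^ 4 + a ^ 3 + a ^ 2 + a + 1 := by
    nlinarith [sq_nonneg (2 * a ^ 2 + a), sq_nonneg (a + 2), sq_nonneg a]
  obtain ⟨P, hP⟩ := Int.eq_ofNat_of_zero_le hpos.le
  have hP0 : P ≠ 0 := by rintro rfl; simp [hP] at hpos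
  have hm0 : (a - 1).natAbs ≠ 0 := by omega
  have hn : (a ^ 5 - 1).natAbs = (a - 1).natAbs * P := by
    have : a ^ 5 - 1 = (a - 1) * P := by rw [← hP]; ring
    rw [this, Int.natAbs_mul, Int.natAbs_natCast]
  have hn0 : (a ^ 5 - 1).natAbs ≠ 0 := hn ▸ mul_ne_zero hm0 hP0
  obtain ⟨c, hc⟩ : ∃ c : ℤ, (P : ℤ) = 25 * c + 5 := by
    obtain ⟨b, hb⟩ := h5
    obtain rfl : a = 5 * b + 1 := by linarith
    exact ⟨25 * b ^ 4 + 25 * b ^ 3 + 10 * b ^ 2 + 2 * b, by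
      rw [← hP]; ring⟩
  have hset : P.primeFactors =
      insert 5 ((a ^ 5 - 1).natAbs.primeFactors.filter (fun r => eOrd r a = 5)) := by
    ext r
    simp only [Finset.mem_insert, Finset.mem_filter, Nat.mem_primeFactors_of_ne_zero hP0,
      Nat.mem_primeFactors_of_ne_zero hn0]
    rw [and_assoc, ← Int.natCast_dvd]
    by_cases hr : r.Prime
    · rw [eOrd_eq_five_iff h5 hr, hP, Int.natCast_dvd_natCast]
      by_cases h : r = 5
      · subst h
        simp only [hr, true_and, true_or, iff_true]
        omega
      · simp [hr, h]
    · have : r ≠ 5 := by rintro rfl; exact hr Nat.prime_five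
      simp [hr, this]
  have hnot : 5 ∉ (a ^ 5 - 1).natAbs.primeFactors.filter (fun r => eOrd r a = 5) := by
    rw [Finset.mem_filter, Nat.mem_primeFactors_of_ne_zero hn0, ← Int.natCast_dvd]
    rintro ⟨⟨hp, h⟩, h'⟩
    exact ((eOrd_eq_five_iff h5 hp).mp ⟨h, h'⟩).2 rfl
  have hfive : P.factorization 5 = 1 := by
    have h1 : 5 ^ 1 ∣ P := by omega
    have h2 : ¬ 5 ^ 2 ∣ P := by omega
    rw [Nat.prime_five.pow_dvd_iff_le_factorization hP0] at h1 h2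
    omega
  have key : P = 5 * kPart 5 a := by
    conv_lhs => rw [← Nat.prod_factorization_pow_eq_self hP0]
    rw [Finsupp.prod, Nat.support_factorization, hset, Finset.prod_insert hnot, hfive, pow_one,
      kPart]
    congr 1
    refine Finset.prod_congr rfl fun r hr => ?_
    rw [Finset.mem_filter, Nat.mem_primeFactors_of_ne_zero hn0, ← Int.natCast_dvd] at hr
    obtain ⟨⟨hp, hdvd⟩, hord⟩ := hr
    obtain ⟨hd, hne⟩ := (eOrd_eq_five_iff h5 hp).mp ⟨hdvd, hord⟩
    have hna : ¬ r ∣ (a - 1).natAbs := by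
      rw [← Int.natCast_dvd]
      exact not_dvd_sub_one_of_dvd_cyclotomic_five hp hne hd
    rw [hn, Nat.factorization_mul hm0 hP0, Finsupp.add_apply,
      Nat.factorization_eq_zero_of_not_dvd hna, zero_add]
  rw [hP, key]
  push_cast
  rfl

/-- An integer combination of `x` and `y` equal to `N` is a multiple of their gcd. -/
theorem Int.gcd_dvd_of_combination {x y : ℤ} {N : ℕ} (s t : ℤ) (h : s * x + t * y = N) :
    Int.gcd x y ∣ N := by
  rw [← Int.natCast_dvd_natCast, ← h]
  exact dvd_add ((Int.gcd_dvd_left ..).mul_left s) ((Int.gcd_dvd_right ..).mul_left t)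

/-- For `|a| > 1` with `gcd(5, a-1) = 5`: `gcd(7k_5(a)-1, Φ_4(a²))` divides `2·1297`,
`gcd(7k_5(a)-1, Φ_3(a²))` divides `3·13·109`, `gcd(k_5(a)-1, Φ_4(a²))` divides `2·97`
and `gcd(k_5(a)-1, Φ_3(a²))` divides `3·7·31`. -/
theorem gcd_k5_cyclotomic_of_five (a : ℤ) (ha : 1 < a.natAbs)
    (h5 : Int.gcd 5 (a - 1) = 5) :
    Int.gcd (7 * (kPart 5 a : ℤ) - 1) ((Polynomial.cyclotomic 4 ℤ).eval (a ^ 2)) ∣ 2 * 1297 ∧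
    Int.gcd (7 * (kPart 5 a : ℤ) - 1) ((Polynomial.cyclotomic 3 ℤ).eval (a ^ 2)) ∣ 3 * 13 * 109 ∧
    Int.gcd ((kPart 5 a : ℤ) - 1) ((Polynomial.cyclotomic 4 ℤ).eval (a ^ 2)) ∣ 2 * 97 ∧
    Int.gcd ((kPart 5 a : ℤ) - 1) ((Polynomial.cyclotomic 3 ℤ).eval (a ^ 2)) ∣ 3 * 7 * 31 := by
  have hdvd : (5 : ℤ) ∣ a - 1 := (Int.gcd_eq_left_iff_dvd (by norm_num)).mp (by exact_mod_cast h5)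
  have hk := five_mul_kPart_five ha hdvd
  have hfour : (Polynomial.cyclotomic 4 ℤ).eval (a ^ 2) = a ^ 4 + 1 := by
    have h := Polynomial.cyclotomic_prime_pow_eq_geom_sum (R := ℤ) (n := 1) Nat.prime_two
    norm_num [Finset.sum_range_succ] at h
    rw [h]
    simp
    ring
  have hthree : (Polynomial.cyclotomic 3 ℤ).eval (a ^ 2) = a ^ 4 + a ^ 2 + 1 := by
    rw [Polynomial.cyclotomic_three]
    simp
    ring
  rw [hfour, hthree]
  refine ⟨?_, ?_, ?_, ?_⟩
  · refine Int.gcd_dvd_of_combination (5 * (-215 - 7 * a + 42 * a ^ 2 - 252 * a ^ 3))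
      (3024 + 1519 * a + 1470 * a ^ 2 + 1764 * a ^ 3) ?_
    push_cast
    linear_combination 7 * (-215 - 7 * a + 42 * a ^ 2 - 252 * a ^ 3) * hk
  · refine Int.gcd_dvd_of_combination (5 * (-125 - 518 * a + 245 * a ^ 2 - 175 * a ^ 3))
      (4501 + 1911 * a - 490 * a ^ 2 + 1225 * a ^ 3) ?_
    push_cast
    linear_combination 7 * (-125 - 518 * a + 245 * a ^ 2 - 175 * a ^ 3) * hk
  · refine Int.gcd_dvd_of_combination (5 * (-35 - 4 * a - 6 * a ^ 2 - 9 * a ^ 3))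
      (54 + 19 * a + 15 * a ^ 2 + 9 * a ^ 3) ?_
    push_cast
    linear_combination (-35 - 4 * a - 6 * a ^ 2 - 9 * a ^ 3) * hk
  · refine Int.gcd_dvd_of_combination (5 * (-125 - 26 * a + 5 * a ^ 2 - 25 * a ^ 3))
      (151 + 21 * a + 20 * a ^ 2 + 25 * a ^ 3) ?_
    push_cast
    linear_combination (-125 - 26 * a + 5 * a ^ 2 - 25 * a ^ 3) * hk
end

section
/- If a and b are integers with |a| > 1 and |b| > 1 such that (a⁵ − 1)/(a − 1) = (b⁵ − 1)/(b − 1), then a = b. Equivalently, the function x ↦ x⁴ + x³ + x² + x + 1 is injective on the set of integers of absolute value greater than 1. -/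
/-- The map `x ↦ x⁴ + x³ + x² + x + 1 = (x⁵ - 1)/(x - 1)` is injective on integers
of absolute value greater than `1`. -/
theorem fifth_cyclotomic_injective (a b : ℤ) (ha : 1 < a.natAbs) (hb : 1 < b.natAbs)
    (h : a ^ 4 + a ^ 3 + a ^ 2 + a + 1 = b ^ 4 + b ^ 3 + b ^ 2 + b + 1) :
    a = b := by
  by_contra hab
  have hquot : (a ^ 2 + b ^ 2) * (2 * (a + b) + 1) + ((a + b + 1) ^ 2 + 1) = 0 := by
    apply mul_left_cancel₀ (sub_ne_zero.mpr hab)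
    linear_combination 2 * h
  have ha' : 2 ≤ a ∨ a ≤ -2 := by omega
  have hsq : 4 ≤ a ^ 2 := by rcases ha' with h | h <;> nlinarith
  have hq : 4 ≤ a ^ 2 + b ^ 2 := by linarith [sq_nonneg b]
  have hqs : (a + b) ^ 2 ≤ 2 * (a ^ 2 + b ^ 2) := by linarith [sq_nonneg (a - b)]
  generalize a ^ 2 + b ^ 2 = q at *
  generalize a + b = s at *
  rcases le_or_gt 0 s with hs | hs
  · nlinarith [mul_nonneg (by linarith : 0 ≤ q) hs]
  · obtain rfl | hs2 : s = -1 ∨ s ≤ -2 := by omega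
    · linarith
    · nlinarith [mul_nonneg (by linarith : 0 ≤ 2 * q - s ^ 2) (by linarith : 0 ≤ -(2 * s + 1)),
        mul_nonneg (sq_nonneg s) (by linarith : 0 ≤ -2 - s)]
end
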